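/- Let d ≥ 2 and m ≥ 1 be integers, and let n ≥ 1 be an integer with m ≤ d^{n+1} − 3. Then B(d,m,n) is a d-adic rational number: there exist an integer k and a nonnegative integer s such that B(d,m,n) = k / d^s. -/

import Mathlib

/-- Generalized binomial coefficient `C_j(x) = x(x-1)⋯(x-j+1)/j!`, with `C_0(x) = 1`. -/
noncomputable def genBinom (x : ℚ) (j : ℕ) : ℚ :=
  (∏ i ∈ Finset.range j, (x - (i : ℚ))) / (Nat.factorial j : ℚ)

/-- The Ewing–Schober combinatorial formula `B(d,m,n)`: the sum is over all tuples
`(j_1,…,j_n)` of nonnegative integers (here `j : Fin n → ℕ`, 0-indexed, so `j k`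
corresponds to `j_{k+1}`) satisfying `Σ_{k=1}^n (d^{n-k+1} - 1) j_k = m + 1`, of
`Π_{k=1}^n C_{j_k}(m/d^{n-k+1} - Σ_{l=1}^{k-1} d^{k-l} j_l)`, multiplied by `-(1/m)`. -/
noncomputable def multibrotB (d m n : ℕ) : ℚ :=
  -(1 / (m : ℚ)) * ∑ᶠ j : Fin n → ℕ,
    if (∑ k : Fin n, (d ^ (n - k.val) - 1) * j k) = m + 1 then
      ∏ k : Fin n,
        genBinom ((m : ℚ) / (d : ℚ) ^ (n - k.val)
          - ∑ l ∈ Finset.univ.filter (fun l : Fin n => l < k),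
              (d : ℚ) ^ (k.val - l.val) * ((j l : ℕ) : ℚ)) (j k)
    else 0

/-- The ring `ℤ[1/d]` of `d`-adic rational numbers. -/
def dAdicRationals (d : ℕ) (hd : d ≠ 0) : Subring ℚ where
  carrier := {x | ∃ (k : ℤ) (s : ℕ), x = (k : ℚ) / (d : ℚ) ^ s}
  mul_mem' := by
    rintro _ _ ⟨a, s, rfl⟩ ⟨b, t, rfl⟩
    exact ⟨a * b, s + t, by push_cast; rw [pow_add, div_mul_div_comm]⟩
  one_mem' := ⟨1, 0, by simp⟩
  add_mem' := by
    rintro _ _ ⟨a, s, rfl⟩ ⟨b, t, rfl⟩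
    have : (d : ℚ) ≠ 0 := by exact_mod_cast hd
    refine ⟨a * d ^ t + b * d ^ s, s + t, ?_⟩
    push_cast
    field_simp
    ring
  zero_mem' := ⟨0, 0, by simp⟩
  neg_mem' := by
    rintro _ ⟨a, s, rfl⟩
    exact ⟨-a, s, by push_cast; ring⟩

theorem mem_dAdicRationals {d : ℕ} {hd : d ≠ 0} {x : ℚ} :
    x ∈ dAdicRationals d hd ↔ ∃ (k : ℤ) (s : ℕ), x = (k : ℚ) / (d : ℚ) ^ s := Iff.rfl

theorem Nat.exists_mul_eq_dvd_pow_coprime (d n : ℕ) (hn : n ≠ 0) :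
    ∃ a b N : ℕ, n = a * b ∧ a ∣ d ^ N ∧ b.Coprime d := by
  induction n using Nat.strong_induction_on with
  | _ n ih =>
    by_cases h : n.Coprime d
    · exact ⟨1, n, 0, by simp, by simp, h⟩
    · obtain ⟨q, hq⟩ := Nat.gcd_dvd_left n d
      have hg : 1 < n.gcd d := by
        have := Nat.gcd_pos_of_pos_left d (Nat.pos_of_ne_zero hn)
        have : n.gcd d ≠ 1 := h
        omega
      have hq0 : q ≠ 0 := by
        rintro rfl
        exact hn (by simpa using hq)
      have hlt : q < n := by
        have := Nat.mul_lt_mul_of_pos_right hg (Nat.pos_of_ne_zero hq0)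
        omega
      obtain ⟨a, b, N, rfl, ha, hb⟩ := ih q hlt hq0
      refine ⟨n.gcd d * a, b, N + 1, by rw [mul_assoc]; exact hq, ?_, hb⟩
      rw [pow_succ']
      exact mul_dvd_mul (Nat.gcd_dvd_right n d) ha

theorem Int.factorial_dvd_prod_range_sub (a : ℤ) (j : ℕ) :
    (j.factorial : ℤ) ∣ ∏ i ∈ Finset.range j, (a - i) := by
  rw [← descPochhammer_eval_eq_prod_range, Polynomial.eval_eq_smeval,
    Ring.descPochhammer_eq_factorial_smul_choose, nsmul_eq_mul]
  exact dvd_mul_right _ _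

theorem Int.dvd_prod_range_sub_mul {b D : ℤ} (hbD : IsCoprime b D) {j : ℕ}
    (hb : b ∣ j.factorial) (a : ℤ) : b ∣ ∏ i ∈ Finset.range j, (a - i * D) := by
  obtain ⟨u, e, h⟩ := hbD
  have he : IsCoprime b (e ^ j) := IsCoprime.pow_right ⟨u, D, by linarith⟩
  refine he.dvd_of_dvd_mul_left ?_
  have hmod : (e ^ j * ∏ i ∈ Finset.range j, (a - i * D)) ≡
      ∏ i ∈ Finset.range j, (e * a - i) [ZMOD b] := by
    rw [← Finset.card_range j, ← Finset.prod_const, Finset.card_range,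
      ← Finset.prod_mul_distrib]
    refine Int.ModEq.prod fun i _ => (Int.modEq_iff_dvd.2 ⟨-(i * u), ?_⟩)
    linear_combination (i : ℤ) * h
  exact (dvd_iff_dvd_of_dvd_sub hmod.dvd).1 (hb.trans (Int.factorial_dvd_prod_range_sub _ _))

theorem genBinom_mem_dAdicRationals {d : ℕ} {hd : d ≠ 0} {x : ℚ}
    (hx : x ∈ dAdicRationals d hd) (j : ℕ) : genBinom x j ∈ dAdicRationals d hd := by
  obtain ⟨k, s, rfl⟩ := hx
  obtain ⟨a, b, N, hab, ⟨c, hc⟩, hb⟩ :=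
    Nat.exists_mul_eq_dvd_pow_coprime d j.factorial j.factorial_ne_zero
  have hcop : IsCoprime (b : ℤ) ((d : ℤ) ^ s) :=
    IsCoprime.pow_right (Nat.isCoprime_iff_coprime.2 hb)
  obtain ⟨q, hq⟩ := Int.dvd_prod_range_sub_mul hcop
    (j := j) (by rw [hab]; push_cast; exact dvd_mul_left _ _) k
  have hd' : (d : ℚ) ≠ 0 := by exact_mod_cast hd
  have hab0 : a * b ≠ 0 := hab ▸ j.factorial_ne_zero
  have ha0 : (a : ℚ) ≠ 0 := by exact_mod_cast left_ne_zero_of_mul hab0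
  have hb0 : (b : ℚ) ≠ 0 := by exact_mod_cast right_ne_zero_of_mul hab0
  have hprod : (∏ i ∈ Finset.range j, ((k : ℚ) / (d : ℚ) ^ s - i)) * ((d : ℚ) ^ s) ^ j
      = b * q := by
    have hq' : (∏ i ∈ Finset.range j, ((k : ℚ) - i * (d : ℚ) ^ s)) = b * q := by
      exact_mod_cast hq
    rw [← hq', ← Finset.card_range j, ← Finset.prod_const, Finset.card_range,
      ← Finset.prod_mul_distrib]
    refine Finset.prod_congr rfl fun i _ => ?_
    field_simp
  have hcQ : (d : ℚ) ^ N = a * c := by exact_mod_cast hc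
  refine ⟨q * c, s * j + N, ?_⟩
  have hfac : (j.factorial : ℚ) = a * b := by exact_mod_cast hab
  have hc0 : (c : ℚ) ≠ 0 := by
    rintro h
    rw [h, mul_zero] at hcQ
    exact pow_ne_zero _ hd' hcQ
  rw [genBinom, hfac, pow_add, hcQ, pow_mul, div_eq_div_iff (by positivity) (by positivity)]
  push_cast
  linear_combination (a * c : ℚ) * hprod

theorem genBinom_succ_mul (x : ℚ) (j : ℕ) :
    ((j + 1 : ℕ) : ℚ) * genBinom x (j + 1) = x * genBinom (x - 1) j := by
  have hj : (j.factorial : ℚ) ≠ 0 := by exact_mod_cast j.factorial_ne_zero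
  have hj' : ((j + 1 : ℕ) : ℚ) ≠ 0 := by exact_mod_cast j.succ_ne_zero
  rw [genBinom, genBinom, Finset.prod_range_succ', Nat.factorial_succ, Nat.cast_mul]
  have : ∏ i ∈ Finset.range j, (x - ((i + 1 : ℕ) : ℚ)) = ∏ i ∈ Finset.range j, (x - 1 - i) :=
    Finset.prod_congr rfl fun i _ => by push_cast; ring
  rw [this]
  field_simp
  push_cast
  ring

theorem exists_natCast_mul_genBinom_eq {d : ℕ} {hd : d ≠ 0} {x : ℚ}
    (hx : x ∈ dAdicRationals d hd) (j : ℕ) :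
    ∃ y ∈ dAdicRationals d hd, (j : ℚ) * genBinom x j = x * y := by
  cases j with
  | zero => exact ⟨0, zero_mem _, by simp⟩
  | succ j => exact ⟨_, genBinom_mem_dAdicRationals (sub_mem hx (one_mem _)) j,
      genBinom_succ_mul x j⟩

theorem inv_pow_mem_dAdicRationals {d : ℕ} (hd : d ≠ 0) (s : ℕ) :
    1 / (d : ℚ) ^ s ∈ dAdicRationals d hd := ⟨1, s, by simp⟩

/-- The upper argument of the `k`-th generalized binomial coefficient in `multibrotB`. -/
def multibrotArg (d m n : ℕ) (j : Fin n → ℕ) (k : Fin n) : ℚ :=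
  (m : ℚ) / (d : ℚ) ^ (n - k.val)
    - ∑ l ∈ Finset.univ.filter (fun l : Fin n => l < k),
        (d : ℚ) ^ (k.val - l.val) * ((j l : ℕ) : ℚ)

theorem multibrotArg_mem {d : ℕ} (hd : d ≠ 0) (m n : ℕ) (j : Fin n → ℕ) (k : Fin n) :
    multibrotArg d m n j k ∈ dAdicRationals d hd := by
  refine sub_mem ⟨m, n - k.val, by simp⟩ (sum_mem fun l _ => ?_)
  exact mul_mem (pow_mem (natCast_mem _ _) _) (natCast_mem _ _)

theorem natCast_mul_prod_genBinom_div_mem {d : ℕ} (hd : d ≠ 0) {m : ℕ} (hm : m ≠ 0) {n : ℕ}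
    (j : Fin n → ℕ) (k : Fin n) (s : Finset (Fin n)) (hs : ∀ l ≤ k, l ∈ s) :
    (j k : ℚ) * (∏ i ∈ s, genBinom (multibrotArg d m n j i) (j i)) / m
      ∈ dAdicRationals d hd := by
  induction k using WellFoundedLT.induction generalizing s with
  | _ k ih =>
    have hm' : (m : ℚ) ≠ 0 := by exact_mod_cast hm
    obtain ⟨y, hy, hxy⟩ := exists_natCast_mul_genBinom_eq (multibrotArg_mem hd m n j k) (j k)
    set P := ∏ i ∈ s.erase k, genBinom (multibrotArg d m n j i) (j i) with hP
    have hPmem : P ∈ dAdicRationals d hd :=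
      prod_mem fun i _ => genBinom_mem_dAdicRationals (multibrotArg_mem hd m n j i) _
    have key : (j k : ℚ) * (∏ i ∈ s, genBinom (multibrotArg d m n j i) (j i)) / m =
        1 / (d : ℚ) ^ (n - k.val) * (y * P)
          - y * ∑ l ∈ Finset.univ.filter (fun l : Fin n => l < k),
            (d : ℚ) ^ (k.val - l.val) * ((j l : ℚ) * P / m) := by
      have hsum : ∑ l ∈ Finset.univ.filter (fun l : Fin n => l < k),
            (d : ℚ) ^ (k.val - l.val) * ((j l : ℚ) * P / m) =
          (∑ l ∈ Finset.univ.filter (fun l : Fin n => l < k),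
            (d : ℚ) ^ (k.val - l.val) * (j l : ℚ)) * (P / m) := by
        rw [Finset.sum_mul]
        exact Finset.sum_congr rfl fun l _ => by ring
      rw [← Finset.mul_prod_erase s _ (hs k le_rfl), ← hP, ← mul_assoc, hxy, hsum,
        multibrotArg]
      field_simp
    rw [key]
    refine sub_mem (mul_mem (inv_pow_mem_dAdicRationals hd _) (mul_mem hy hPmem))
      (mul_mem hy (sum_mem fun l hl => mul_mem (pow_mem (natCast_mem _ _) _) ?_))
    have hlk : l < k := (Finset.mem_filter.1 hl).2
    exact ih l hlk (s.erase k) fun i hi =>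
      Finset.mem_erase.2 ⟨(hi.trans_lt hlk).ne, hs i (hi.trans hlk.le)⟩

theorem prod_genBinom_div_mem {d : ℕ} (hd : d ≠ 0) {m : ℕ} (hm : m ≠ 0) {n : ℕ}
    (j : Fin n → ℕ) (c : Fin n → ℕ) (hj : ∑ k, c k * j k = m + 1) :
    (∏ i, genBinom (multibrotArg d m n j i) (j i)) / m ∈ dAdicRationals d hd := by
  have hm' : (m : ℚ) ≠ 0 := by exact_mod_cast hm
  set T := ∏ i, genBinom (multibrotArg d m n j i) (j i) with hT
  have hTmem : T ∈ dAdicRationals d hd :=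
    prod_mem fun i _ => genBinom_mem_dAdicRationals (multibrotArg_mem hd m n j i) _
  have hj' : ∑ k, (c k : ℚ) * j k = m + 1 := by exact_mod_cast hj
  have key : T / m = ∑ k, (c k : ℚ) * (j k * T / m) - T := by
    have : ∑ k, (c k : ℚ) * (j k * T / m) = (∑ k, (c k : ℚ) * j k) * (T / m) := by
      rw [Finset.sum_mul]
      exact Finset.sum_congr rfl fun k _ => by ring
    rw [this, hj']
    field_simp
    ring
  rw [key]
  exact sub_mem (sum_mem fun k _ => mul_mem (natCast_mem _ _)
    (natCast_mul_prod_genBinom_div_mem hd hm j k _ fun _ _ => Finset.mem_univ _)) hTmem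

theorem multibrotB_d_adic_rational (d m n : ℕ) (hd : 2 ≤ d) (hm : 1 ≤ m) (hn : 1 ≤ n)
    (hmn : m ≤ d ^ (n + 1) - 3) :
    ∃ (k : ℤ) (s : ℕ), multibrotB d m n = (k : ℚ) / (d : ℚ) ^ s := by
  have hd0 : d ≠ 0 := by omega
  rw [← mem_dAdicRationals (hd := hd0), multibrotB, neg_mul, one_div_mul_eq_div]
  refine neg_mem (finsum_induction (fun z : ℚ => z / m ∈ dAdicRationals d hd0) ?_ ?_ ?_)
  · simp
  · intro x y hx hy
    rw [add_div]
    exact add_mem hx hy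
  · intro j
    split_ifs with h
    · exact prod_genBinom_div_mem hd0 (by omega) j _ h
    · simp
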